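/- Let κ > 0 be the normalizing constant making ρ(x) = κ e^{−1/|x|} χ_{(−1,1)}(x) a probability density, let μ be the associated (zero-mean, by symmetry) probability measure, q its quantile function, φ(θ) = q(|θ|/π), aₙ = (1/π) ∫_{−π}^{π} φ(θ) cos(nθ) dθ, and Φ(z) = Σ_{n=1}^∞ aₙ zⁿ. Then the power series Φ converges on the open unit disc 𝔻 and the image Φ(𝔻) is an unbounded subset of ℂ, even though the support (−1,1) of μ is bounded and connected. -/

import Mathlib

open MeasureTheory Filter Set
open scoped Real

/-- The cumulative distribution function of a measure `μ` on `ℝ`: `F(x) = μ((−∞, x])`. -/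
noncomputable def cdfFn (μ : Measure ℝ) (x : ℝ) : ℝ := (μ (Iic x)).toReal

/-- The quantile function of `μ`: `q(u) = inf {x | F(x) ≥ u}`. -/
noncomputable def quantileFn (μ : Measure ℝ) (u : ℝ) : ℝ := sInf {x : ℝ | u ≤ cdfFn μ x}

section Quantile

variable {μ : Measure ℝ}

theorem quantileFn_zero : quantileFn μ 0 = 0 := by
  have : {x : ℝ | 0 ≤ cdfFn μ x} = univ := eq_univ_of_forall fun x => ENNReal.toReal_nonneg
  rw [quantileFn, this, Real.sInf_univ]

variable [IsProbabilityMeasure μ]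

theorem cdfFn_mono : Monotone (cdfFn μ) := fun _ _ h =>
  ENNReal.toReal_mono (measure_ne_top μ _) (measure_mono (Iic_subset_Iic.2 h))

theorem le_of_le_cdfFn {a x u : ℝ} (ha : cdfFn μ a < u) (hx : u ≤ cdfFn μ x) : a ≤ x := by
  by_contra! h
  exact absurd (hx.trans (cdfFn_mono h.le)) (not_le.2 ha)

theorem quantileFn_le {a x u : ℝ} (ha : cdfFn μ a < u) (hx : u ≤ cdfFn μ x) :
    quantileFn μ u ≤ x :=
  csInf_le ⟨a, fun _ hy => le_of_le_cdfFn ha hy⟩ hx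

theorem le_quantileFn {a x u : ℝ} (ha : cdfFn μ a < u) (hx : u ≤ cdfFn μ x) :
    a ≤ quantileFn μ u :=
  le_csInf ⟨x, hx⟩ fun _ hy => le_of_le_cdfFn ha hy

theorem quantileFn_monotoneOn {a b : ℝ} (ha : cdfFn μ a = 0) (hb : cdfFn μ b = 1) :
    MonotoneOn (quantileFn μ) (Ioc 0 1) := fun _ hu _ hv huv =>
  csInf_le_csInf ⟨a, fun _ hy => le_of_le_cdfFn (ha.trans_lt hu.1) hy⟩ ⟨b, hv.2.trans hb.ge⟩
    fun _ hy => huv.trans hy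

theorem abs_quantileFn_le_one (ha : cdfFn μ (-1) = 0) (hb : cdfFn μ 1 = 1) {u : ℝ}
    (hu : u ∈ Icc (0 : ℝ) 1) : |quantileFn μ u| ≤ 1 := by
  rcases hu.1.eq_or_lt with rfl | h
  · simp [quantileFn_zero]
  · exact abs_le.2 ⟨le_quantileFn (ha.trans_lt h) (hu.2.trans hb.ge),
      quantileFn_le (ha.trans_lt h) (hu.2.trans hb.ge)⟩

theorem quantileFn_nonpos {a : ℝ} (ha : cdfFn μ a = 0) (h0 : cdfFn μ 0 = 1 / 2) {u : ℝ}
    (hu : u ∈ Icc (0 : ℝ) (1 / 2)) : quantileFn μ u ≤ 0 := by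
  rcases hu.1.eq_or_lt with rfl | h
  · rw [quantileFn_zero]
  · exact quantileFn_le (ha.trans_lt h) (hu.2.trans h0.ge)

theorem quantileFn_nonneg {b : ℝ} (h0 : cdfFn μ 0 = 1 / 2) (hb : cdfFn μ b = 1) {u : ℝ}
    (hu : u ∈ Ioc (1 / 2 : ℝ) 1) : 0 ≤ quantileFn μ u :=
  le_quantileFn (h0.trans_lt hu.1) (hu.2.trans hb.ge)

theorem intervalIntegrable_quantileFn_abs_div_pi (ha : cdfFn μ (-1) = 0) (hb : cdfFn μ 1 = 1) :
    IntervalIntegrable (fun θ => quantileFn μ (|θ| / π)) volume (-π) π := by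
  have key : IntervalIntegrable (fun θ => quantileFn μ (|θ| / π)) volume 0 π := by
    rw [intervalIntegrable_iff_integrableOn_Ioc_of_le Real.pi_pos.le]
    have hmem : ∀ θ ∈ Ioc 0 π, |θ| / π ∈ Ioc (0 : ℝ) 1 := fun θ hθ => by
      rw [abs_of_pos hθ.1]
      exact ⟨div_pos hθ.1 Real.pi_pos, (div_le_one Real.pi_pos).2 hθ.2⟩
    have hmono : MonotoneOn (fun θ => quantileFn μ (|θ| / π)) (Ioc 0 π) := fun x hx y hy hxy =>
      quantileFn_monotoneOn ha hb (hmem x hx) (hmem y hy) (by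
        rw [abs_of_pos hx.1, abs_of_pos hy.1]
        exact div_le_div_of_nonneg_right hxy Real.pi_pos.le)
    refine IntegrableOn.of_bound (C := 1) (by simp)
      (aemeasurable_restrict_of_monotoneOn measurableSet_Ioc hmono).aestronglyMeasurable ?_
    refine (ae_restrict_iff' measurableSet_Ioc).2 (Eventually.of_forall fun θ hθ => ?_)
    exact abs_quantileFn_le_one ha hb (Ioc_subset_Icc_self (hmem θ hθ))
  refine IntervalIntegrable.trans (b := 0) ?_ key
  rw [IntervalIntegrable.iff_comp_neg]
  simpa using key.symm

end Quantile

/-- The density `κ e^{−1/|x|}` on `(−1,1)`, flat to infinite order at the origin. -/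
noncomputable def flatDensity (κ x : ℝ) : ENNReal :=
  ENNReal.ofReal (if x ∈ Ioo (-1 : ℝ) 1 then κ * Real.exp (-1 / |x|) else 0)

section FlatDensity

variable {κ : ℝ}

theorem measurable_flatDensity : Measurable (flatDensity κ) := by
  unfold flatDensity
  refine ENNReal.measurable_ofReal.comp (Measurable.ite measurableSet_Ioo ?_ measurable_const)
  fun_prop

theorem flatDensity_neg (x : ℝ) : flatDensity κ (-x) = flatDensity κ x := by
  have : -x ∈ Ioo (-1 : ℝ) 1 ↔ x ∈ Ioo (-1 : ℝ) 1 := by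
    simp only [mem_Ioo]
    constructor <;> rintro ⟨h, h'⟩ <;> constructor <;> linarith
  simp only [flatDensity, this, abs_neg]

theorem flatDensity_le_of_mem_Ioc (hκ : 0 < κ) {x y : ℝ} (hy : y ∈ Ioc 0 x) :
    flatDensity κ y ≤ ENNReal.ofReal (κ * Real.exp (-1 / x)) := by
  refine ENNReal.ofReal_le_ofReal ?_
  split_ifs
  · have h : -1 / |y| ≤ -1 / x := by
      rw [abs_of_pos hy.1, neg_div, neg_div, neg_le_neg_iff]
      exact one_div_le_one_div_of_le hy.1 hy.2
    gcongr
  · positivity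

theorem withDensity_flatDensity_Iic_neg_one :
    (volume.withDensity (flatDensity κ)) (Iic (-1)) = 0 := by
  rw [withDensity_apply _ measurableSet_Iic]
  refine setLIntegral_eq_zero measurableSet_Iic fun x hx => ?_
  simp [flatDensity, not_lt.2 (mem_Iic.1 hx)]

theorem withDensity_flatDensity_Ioi_one :
    (volume.withDensity (flatDensity κ)) (Ioi 1) = 0 := by
  rw [withDensity_apply _ measurableSet_Ioi]
  refine setLIntegral_eq_zero measurableSet_Ioi fun x hx => ?_
  simp [flatDensity, not_lt.2 (mem_Ioi.1 hx).le]

theorem withDensity_flatDensity_Ioi_zero :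
    (volume.withDensity (flatDensity κ)) (Ioi 0) =
      (volume.withDensity (flatDensity κ)) (Iic 0) := by
  rw [withDensity_apply _ measurableSet_Ioi, withDensity_apply _ measurableSet_Iic,
    ← (Measure.measurePreserving_neg (volume : Measure ℝ)).setLIntegral_comp_preimage
      measurableSet_Iic measurable_flatDensity]
  simp only [flatDensity_neg]
  refine setLIntegral_congr ?_
  simpa using Ioi_ae_eq_Ici

theorem cdfFn_flatDensity_neg_one : cdfFn (volume.withDensity (flatDensity κ)) (-1) = 0 := by
  rw [cdfFn, withDensity_flatDensity_Iic_neg_one, ENNReal.toReal_zero]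

variable [IsProbabilityMeasure (volume.withDensity (flatDensity κ))]

theorem cdfFn_flatDensity_one : cdfFn (volume.withDensity (flatDensity κ)) 1 = 1 := by
  have h := measure_add_measure_compl (μ := volume.withDensity (flatDensity κ))
    (measurableSet_Iic (a := (1 : ℝ)))
  rw [compl_Iic, withDensity_flatDensity_Ioi_one, measure_univ, add_zero] at h
  simp [cdfFn, h]

theorem cdfFn_flatDensity_zero : cdfFn (volume.withDensity (flatDensity κ)) 0 = 1 / 2 := by
  have h := measure_add_measure_compl (μ := volume.withDensity (flatDensity κ))
    (measurableSet_Iic (a := (0 : ℝ)))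
  rw [compl_Iic, withDensity_flatDensity_Ioi_zero, measure_univ] at h
  have h' := congrArg ENNReal.toReal h
  rw [ENNReal.toReal_add (measure_ne_top _ _) (measure_ne_top _ _), ENNReal.toReal_one] at h'
  simp only [cdfFn]
  linarith

theorem cdfFn_flatDensity_le (hκ : 0 < κ) {x : ℝ} (hx : x ∈ Ioc (0 : ℝ) 1) :
    cdfFn (volume.withDensity (flatDensity κ)) x ≤ 1 / 2 + κ * Real.exp (-1 / x) := by
  rw [← cdfFn_flatDensity_zero (κ := κ)]
  have hb : (volume.withDensity (flatDensity κ)) (Ioc 0 x) ≤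
      ENNReal.ofReal (κ * Real.exp (-1 / x)) := by
    rw [withDensity_apply _ measurableSet_Ioc]
    calc ∫⁻ y in Ioc 0 x, flatDensity κ y
        ≤ ∫⁻ _ in Ioc 0 x, ENNReal.ofReal (κ * Real.exp (-1 / x)) :=
          setLIntegral_mono measurable_const fun y hy => flatDensity_le_of_mem_Ioc hκ hy
      _ = ENNReal.ofReal (κ * Real.exp (-1 / x)) * ENNReal.ofReal x := by simp
      _ ≤ _ := mul_le_of_le_one_right' (by simpa using hx.2)
  have hle := (measure_union_le (μ := volume.withDensity (flatDensity κ))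
    (Iic 0) (Ioc 0 x)).trans (add_le_add_right hb _)
  rw [Iic_union_Ioc_eq_Iic hx.1.le] at hle
  have h := ENNReal.toReal_mono
    (ENNReal.add_ne_top.2 ⟨measure_ne_top _ _, ENNReal.ofReal_ne_top⟩) hle
  rwa [ENNReal.toReal_add (measure_ne_top _ _) ENNReal.ofReal_ne_top,
    ENNReal.toReal_ofReal (by positivity)] at h

theorem one_div_log_le_quantileFn_flatDensity (hκ : 0 < κ) {s : ℝ} (hs : 0 < s)
    (hs' : s ≤ π / 2) (hlog : 1 ≤ Real.log (2 * π * κ / s)) :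
    1 / Real.log (2 * π * κ / s) ≤
      quantileFn (volume.withDensity (flatDensity κ)) ((π / 2 + s) / π) := by
  have hpi := Real.pi_pos
  have hu : (π / 2 + s) / π = 1 / 2 + s / π := by field_simp
  refine le_quantileFn (x := 1) ?_ ?_
  · refine (cdfFn_flatDensity_le hκ
      ⟨by positivity, (div_le_one (by positivity)).2 hlog⟩).trans_lt ?_
    have : -1 / (1 / Real.log (2 * π * κ / s)) = Real.log (s / (2 * π * κ)) := by
      rw [← inv_div (2 * π * κ), Real.log_inv]
      simp
    rw [this, Real.exp_log (by positivity), hu]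
    have h1 : κ * (s / (2 * π * κ)) = s / π / 2 := by field_simp
    have h2 : 0 < s / π := by positivity
    linarith
  · rw [cdfFn_flatDensity_one, div_le_one hpi]
    linarith

end FlatDensity

section Kernel

/-- The closed form of `Σ_{n≥1} zⁿ cos(nθ)`. -/
noncomputable def cosineKernel (z : ℂ) (θ : ℝ) : ℂ :=
  (z * Real.cos θ - z ^ 2) / (1 - 2 * z * Real.cos θ + z ^ 2)

theorem one_sub_mul_ne_zero {z w : ℂ} (hz : ‖z‖ < 1) (hw : ‖w‖ = 1) : 1 - z * w ≠ 0 := by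
  intro h
  have h1 : z * w = 1 := (sub_eq_zero.1 h).symm
  have h2 := congrArg norm h1
  rw [norm_mul, hw, mul_one, norm_one] at h2
  exact hz.ne h2

theorem ofReal_cos_eq (θ : ℝ) : (Real.cos θ : ℂ) =
    (Complex.exp (θ * Complex.I) + Complex.exp (-θ * Complex.I)) / 2 := by
  rw [Complex.ofReal_cos, Complex.cos]

theorem norm_exp_neg_mul_I (θ : ℝ) : ‖Complex.exp (-θ * Complex.I)‖ = 1 := by
  rw [← Complex.ofReal_neg]
  exact Complex.norm_exp_ofReal_mul_I _

theorem exp_mul_I_mul_exp_neg (θ : ℝ) :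
    Complex.exp (θ * Complex.I) * Complex.exp (-θ * Complex.I) = 1 := by
  rw [← Complex.exp_add]
  simp

theorem cosineKernel_denom_eq (z : ℂ) (θ : ℝ) : 1 - 2 * z * Real.cos θ + z ^ 2 =
    (1 - z * Complex.exp (θ * Complex.I)) * (1 - z * Complex.exp (-θ * Complex.I)) := by
  rw [ofReal_cos_eq]
  linear_combination (-z ^ 2) * exp_mul_I_mul_exp_neg θ

theorem cosineKernel_denom_ne_zero {z : ℂ} (hz : ‖z‖ < 1) (θ : ℝ) :
    1 - 2 * z * Real.cos θ + z ^ 2 ≠ 0 := by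
  rw [cosineKernel_denom_eq]
  exact mul_ne_zero (one_sub_mul_ne_zero hz (Complex.norm_exp_ofReal_mul_I θ))
    (one_sub_mul_ne_zero hz (norm_exp_neg_mul_I θ))

theorem continuous_cosineKernel {z : ℂ} (hz : ‖z‖ < 1) : Continuous (cosineKernel z) :=
  Continuous.div (by fun_prop) (by fun_prop) (cosineKernel_denom_ne_zero hz)

theorem hasSum_mul_pow_succ {z w : ℂ} (hz : ‖z‖ < 1) (hw : ‖w‖ = 1) :
    HasSum (fun n : ℕ => (z * w) ^ (n + 1)) (z * w / (1 - z * w)) := by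
  have h : ‖z * w‖ < 1 := by rwa [norm_mul, hw, mul_one]
  simpa [pow_succ', div_eq_mul_inv] using (hasSum_geometric_of_norm_lt_one h).mul_left (z * w)

theorem hasSum_cosineKernel {z : ℂ} (hz : ‖z‖ < 1) (θ : ℝ) :
    HasSum (fun n : ℕ => (Real.cos ((n + 1 : ℕ) * θ) : ℂ) * z ^ (n + 1)) (cosineKernel z θ) := by
  have h1 := hasSum_mul_pow_succ hz (Complex.norm_exp_ofReal_mul_I θ)
  have h2 := hasSum_mul_pow_succ hz (norm_exp_neg_mul_I θ)
  have hF : (fun n : ℕ => (Real.cos ((n + 1 : ℕ) * θ) : ℂ) * z ^ (n + 1)) = fun n : ℕ =>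
      ((z * Complex.exp (θ * Complex.I)) ^ (n + 1) +
        (z * Complex.exp (-θ * Complex.I)) ^ (n + 1)) / 2 := by
    funext n
    rw [ofReal_cos_eq, mul_pow, mul_pow, ← Complex.exp_nat_mul, ← Complex.exp_nat_mul]
    push_cast
    ring_nf
  have hS : cosineKernel z θ =
      (z * Complex.exp (θ * Complex.I) / (1 - z * Complex.exp (θ * Complex.I)) +
        z * Complex.exp (-θ * Complex.I) / (1 - z * Complex.exp (-θ * Complex.I))) / 2 := by
    have e1 := one_sub_mul_ne_zero hz (Complex.norm_exp_ofReal_mul_I θ)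
    have e2 := one_sub_mul_ne_zero hz (norm_exp_neg_mul_I θ)
    rw [cosineKernel, cosineKernel_denom_eq, ofReal_cos_eq, div_add_div _ _ e1 e2, div_div,
      div_eq_div_iff (mul_ne_zero e1 e2) (mul_ne_zero (mul_ne_zero e1 e2) two_ne_zero)]
    linear_combination (2 * z ^ 2 *
      ((1 - z * Complex.exp (θ * Complex.I)) * (1 - z * Complex.exp (-θ * Complex.I)))) *
        exp_mul_I_mul_exp_neg θ
  rw [hF, hS]
  exact (h1.add h2).div_const 2

theorem im_cosineKernel_mul_I {r : ℝ} (θ : ℝ) :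
    (cosineKernel (r * Complex.I) θ).im =
      r * (1 + r ^ 2) * Real.cos θ / ((1 - r ^ 2) ^ 2 + (2 * r * Real.cos θ) ^ 2) := by
  have h1 : (r * Complex.I * Real.cos θ - (r * Complex.I) ^ 2 : ℂ) =
      ⟨r ^ 2, r * Real.cos θ⟩ := by
    apply Complex.ext <;> simp [pow_two, -Complex.ofReal_cos]
  have h2 : (1 - 2 * (r * Complex.I) * Real.cos θ + (r * Complex.I) ^ 2 : ℂ) =
      ⟨1 - r ^ 2, -(2 * r * Real.cos θ)⟩ := by
    apply Complex.ext <;> simp [pow_two, -Complex.ofReal_cos] ; ring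
  rw [cosineKernel, h1, h2, Complex.div_im, Complex.normSq_mk]
  ring

theorem hasSum_cosineCoeff {f : ℝ → ℝ} (hf : IntervalIntegrable f volume (-π) π)
    (hb : ∀ θ ∈ Icc (-π) π, |f θ| ≤ 1) {z : ℂ} (hz : ‖z‖ < 1) :
    HasSum (fun n : ℕ => (((1 / π) * ∫ θ in (-π)..π, f θ * Real.cos ((n + 1 : ℕ) * θ) : ℝ) : ℂ) *
      z ^ (n + 1)) ((1 / π : ℝ) * ∫ θ in (-π)..π, (f θ : ℂ) * cosineKernel z θ) := by
  have hpi := Real.pi_pos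
  have hle : -π ≤ π := by linarith
  have h : HasSum (fun n : ℕ => ∫ θ in (-π)..π,
      (f θ : ℂ) * ((Real.cos ((n + 1 : ℕ) * θ) : ℂ) * z ^ (n + 1)))
      (∫ θ in (-π)..π, (f θ : ℂ) * cosineKernel z θ) := by
    have hsum : Summable fun n : ℕ => ‖z‖ ^ (n + 1) :=
      (summable_nat_add_iff 1).2 (summable_geometric_of_lt_one (norm_nonneg z) hz)
    refine intervalIntegral.hasSum_integral_of_dominated_convergence
      (fun n _ => ‖z‖ ^ (n + 1)) (fun n => ?_) (fun n => ?_) (Eventually.of_forall fun _ _ => hsum)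
      intervalIntegrable_const
      (Eventually.of_forall fun θ _ => (hasSum_cosineKernel hz θ).mul_left _)
    · have hm := (Complex.continuous_ofReal.comp_aestronglyMeasurable hf.def'.aestronglyMeasurable)
      exact hm.mul (Continuous.aestronglyMeasurable (by fun_prop))
    · refine Eventually.of_forall fun θ hθ => ?_
      rw [uIoc_of_le hle] at hθ
      rw [norm_mul, norm_mul, norm_pow, Complex.norm_real, Complex.norm_real, ← mul_assoc]
      exact mul_le_of_le_one_left (by positivity)
        (mul_le_one₀ (hb θ (Ioc_subset_Icc_self hθ)) (norm_nonneg _) (Real.abs_cos_le_one _))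
  refine (h.mul_left ((1 / π : ℝ) : ℂ)).congr_fun fun n => ?_
  rw [Complex.ofReal_mul, mul_assoc, ← intervalIntegral.integral_ofReal,
    ← intervalIntegral.integral_mul_const]
  congr 2
  funext θ
  push_cast
  ring

theorem im_integral_mul_cosineKernel {f : ℝ → ℝ} (hf : IntervalIntegrable f volume (-π) π)
    {r : ℝ} (hr : r ∈ Ioo (0 : ℝ) 1) :
    (((1 / π : ℝ) : ℂ) * ∫ θ in (-π)..π, (f θ : ℂ) * cosineKernel (r * Complex.I) θ).im =
      (1 / π) * ∫ θ in (-π)..π, f θ * (cosineKernel (r * Complex.I) θ).im := by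
  have hz : ‖(r * Complex.I : ℂ)‖ < 1 := by simpa [abs_of_pos hr.1] using hr.2
  have hint : IntervalIntegrable (fun θ => (f θ : ℂ) * cosineKernel (r * Complex.I) θ)
      volume (-π) π :=
    IntervalIntegrable.mul_continuousOn ⟨hf.1.ofReal, hf.2.ofReal⟩
      (continuous_cosineKernel hz).continuousOn
  rw [Complex.im_ofReal_mul]
  congr 1
  have := Complex.imCLM.intervalIntegral_comp_comm hint
  simpa [Complex.im_ofReal_mul] using this.symm

end Kernel

open scoped Topology in
theorem tendsto_integral_one_div_mul_log {A δ : ℝ} (hA0 : 0 < A) (hδ : 0 < δ)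
    (hA : 1 ≤ Real.log (A / δ)) :
    Tendsto (fun ε => ∫ s in ε..δ, 1 / (s * Real.log (A / s))) (𝓝[>] 0) atTop := by
  have hlog : ∀ s ∈ Ioc 0 δ, 1 ≤ Real.log (A / s) := fun s hs =>
    hA.trans (Real.log_le_log (by positivity) (div_le_div_of_nonneg_left hA0.le hs.1 hs.2))
  have heq : (fun ε => Real.log (Real.log (A / ε)) - Real.log (Real.log (A / δ))) =ᶠ[𝓝[>] 0]
      fun ε => ∫ s in ε..δ, 1 / (s * Real.log (A / s)) := by
    filter_upwards [Ioo_mem_nhdsGT hδ] with ε hε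
    have hmem : ∀ s ∈ uIcc ε δ, s ∈ Ioc 0 δ := fun s hs => by
      rw [uIcc_of_le hε.2.le] at hs
      exact ⟨hε.1.trans_le hs.1, hs.2⟩
    have hd : ∀ s ∈ uIcc ε δ, HasDerivAt (fun s => -Real.log (Real.log (A / s)))
        (1 / (s * Real.log (A / s))) s := fun s hs => by
      have hs0 := (hmem s hs).1
      have hl := hlog s (hmem s hs)
      have h1 := ((hasDerivAt_inv hs0.ne').const_mul A).log (by positivity)
      have h2 := (h1.log (by rw [← div_eq_mul_inv]; positivity)).neg
      simp only [← div_eq_mul_inv] at h2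
      refine h2.congr_deriv ?_
      field_simp
    have hc : ContinuousOn (fun s => 1 / (s * Real.log (A / s))) (uIcc ε δ) := fun s hs => by
      have hs0 := (hmem s hs).1
      have hl := hlog s (hmem s hs)
      refine ContinuousAt.continuousWithinAt (continuousAt_const.div (continuousAt_id.mul
        ((continuousAt_const.div continuousAt_id hs0.ne').log ?_)) ?_)
      · exact (by positivity : A / s ≠ 0)
      · exact (by positivity : s * Real.log (A / s) ≠ 0)
    rw [intervalIntegral.integral_eq_sub_of_hasDerivAt hd hc.intervalIntegrable]
    ring
  refine Tendsto.congr' heq (tendsto_atTop_add_const_right _ _ ?_)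
  refine Real.tendsto_log_atTop.comp (Real.tendsto_log_atTop.comp ?_)
  exact (tendsto_inv_nhdsGT_zero.const_mul_atTop hA0).congr fun _ => (div_eq_mul_inv _ _).symm

theorem one_div_le_neg_im_cosineKernel {ε s : ℝ} (hε : 0 < ε) (hs : s ∈ Icc ε 1) :
    1 / (8 * s) ≤ -(cosineKernel ((1 - ε / 4 : ℝ) * Complex.I) (s + π / 2)).im := by
  have hs0 : 0 < s := hε.trans_le hs.1
  have hε1 : ε ≤ 1 := hs.1.trans hs.2
  have hS : Real.sin s ≤ s := Real.sin_le hs0.le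
  have hS' : s / 2 ≤ Real.sin s := by
    have h := Real.mul_le_sin hs0.le (by linarith [Real.pi_gt_three, hs.2])
    have h2 : 1 / 2 ≤ 2 / π := by
      rw [div_le_div_iff₀ two_pos Real.pi_pos]
      linarith [Real.pi_lt_four]
    nlinarith
  rw [im_cosineKernel_mul_I, Real.cos_add_pi_div_two]
  set S := Real.sin s
  obtain ⟨r, hr⟩ : ∃ r, r = 1 - ε / 4 := ⟨_, rfl⟩
  rw [← hr]
  have hr0 : 3 / 4 ≤ r := by linarith
  have hr1 : r ≤ 1 := by linarith
  have hS0 : 0 < S := by linarith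
  have hsmall : 1 - r ^ 2 ≤ 2 * r * S := by nlinarith [hs.1]
  have hD : (1 - r ^ 2) ^ 2 + (2 * r * -S) ^ 2 ≤ 8 * r ^ 2 * S ^ 2 := by
    have := pow_le_pow_left₀ (by nlinarith) hsmall 2
    nlinarith
  have hD0 : 0 < (1 - r ^ 2) ^ 2 + (2 * r * -S) ^ 2 := by
    have : 2 * r * -S ≠ 0 := by
      have : 0 < r * S := by positivity
      nlinarith
    positivity
  rw [← neg_div, div_le_div_iff₀ (by positivity) hD0]
  have h1 : r ^ 2 * S * S ≤ r ^ 2 * S * s := by gcongr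
  have h2 : r ^ 2 * (S * s) ≤ r * (1 + r ^ 2) * (S * s) := by
    gcongr
    nlinarith
  nlinarith

theorem im_cosineKernel_nonneg {r : ℝ} (hr : 0 ≤ r) {θ : ℝ} (hθ : |θ| ≤ π / 2) :
    0 ≤ (cosineKernel (r * Complex.I) θ).im := by
  rw [im_cosineKernel_mul_I]
  have := Real.cos_nonneg_of_mem_Icc (abs_le.1 hθ)
  positivity

theorem im_cosineKernel_nonpos {r : ℝ} (hr : 0 ≤ r) {θ : ℝ} (hθ : π / 2 ≤ |θ|) (hθ' : |θ| ≤ π) :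
    (cosineKernel (r * Complex.I) θ).im ≤ 0 := by
  rw [im_cosineKernel_mul_I]
  have : Real.cos θ ≤ 0 := by
    rw [← Real.cos_abs]
    exact Real.cos_nonpos_of_pi_div_two_le_of_le hθ (by linarith [Real.pi_pos])
  exact div_nonpos_of_nonpos_of_nonneg (mul_nonpos_of_nonneg_of_nonpos (by positivity) this)
    (by positivity)

section Divergence

variable {κ : ℝ} [IsProbabilityMeasure (volume.withDensity (flatDensity κ))]

theorem quantileFn_flatDensity_mul_im_cosineKernel_nonpos {r : ℝ} (hr : 0 ≤ r) {θ : ℝ}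
    (hθ : θ ∈ Icc (-π) π) : quantileFn (volume.withDensity (flatDensity κ)) (|θ| / π) *
      (cosineKernel (r * Complex.I) θ).im ≤ 0 := by
  have hpi := Real.pi_pos
  have hle : |θ| ≤ π := abs_le.2 hθ
  rcases le_or_gt |θ| (π / 2) with h | h
  · refine mul_nonpos_of_nonpos_of_nonneg (quantileFn_nonpos cdfFn_flatDensity_neg_one
      cdfFn_flatDensity_zero ⟨by positivity, ?_⟩) (im_cosineKernel_nonneg hr h)
    rw [div_le_iff₀ hpi]
    linarith
  · refine mul_nonpos_of_nonneg_of_nonpos (quantileFn_nonneg cdfFn_flatDensity_zero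
      cdfFn_flatDensity_one ⟨?_, (div_le_one hpi).2 hle⟩) (im_cosineKernel_nonpos hr h.le hle)
    rw [lt_div_iff₀ hpi]
    linarith

theorem integral_one_div_mul_log_le (hκ : 0 < κ) {ε δ : ℝ} (hε : 0 < ε) (hεδ : ε ≤ δ)
    (hδ : δ ≤ 1) (hlog : 1 ≤ Real.log (2 * π * κ / δ)) :
    (1 / 8) * ∫ s in ε..δ, 1 / (s * Real.log (2 * π * κ / s)) ≤
      -∫ θ in (-π)..π, quantileFn (volume.withDensity (flatDensity κ)) (|θ| / π) *
        (cosineKernel ((1 - ε / 4 : ℝ) * Complex.I) θ).im := by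
  have hpi := Real.pi_gt_three
  have hr : ‖((1 - ε / 4 : ℝ) * Complex.I : ℂ)‖ < 1 := by
    rw [norm_mul, Complex.norm_I, mul_one, Complex.norm_real, Real.norm_eq_abs, abs_lt]
    constructor <;> linarith
  have hlog' : ∀ s ∈ Icc ε δ, 1 ≤ Real.log (2 * π * κ / s) := fun s hs => by
    have hs0 : 0 < s := hε.trans_le hs.1
    have hδ0 : 0 < δ := hε.trans_le hεδ
    exact hlog.trans (Real.log_le_log (by positivity)
      (div_le_div_of_nonneg_left (by positivity) hs0 hs.2))
  set g : ℝ → ℝ := fun θ => -(quantileFn (volume.withDensity (flatDensity κ)) (|θ| / π) *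
    (cosineKernel ((1 - ε / 4 : ℝ) * Complex.I) θ).im) with hg
  have hgi : IntervalIntegrable g volume (-π) π :=
    ((intervalIntegrable_quantileFn_abs_div_pi cdfFn_flatDensity_neg_one
      cdfFn_flatDensity_one).mul_continuousOn
        (Complex.continuous_im.comp (continuous_cosineKernel hr)).continuousOn).neg
  have hle : -π ≤ π := by linarith
  have hsub : uIcc (ε + π / 2) (δ + π / 2) ⊆ uIcc (-π) π := by
    rw [uIcc_of_le (by linarith), uIcc_of_le hle]
    exact Icc_subset_Icc (by linarith) (by linarith)
  have hmono : ∫ θ in (ε + π / 2)..(δ + π / 2), g θ ≤ ∫ θ in (-π)..π, g θ := by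
    refine intervalIntegral.integral_mono_interval (by linarith) (by linarith) (by linarith)
      ((ae_restrict_iff' measurableSet_Ioc).2 (Eventually.of_forall fun θ hθ => ?_)) hgi
    exact neg_nonneg.2 (quantileFn_flatDensity_mul_im_cosineKernel_nonpos (by linarith)
      (Ioc_subset_Icc_self hθ))
  rw [← intervalIntegral.integral_neg]
  refine le_trans ?_ hmono
  rw [← intervalIntegral.integral_comp_add_right, ← intervalIntegral.integral_const_mul]
  refine intervalIntegral.integral_mono_on hεδ (ContinuousOn.intervalIntegrable ?_) ?_ ?_
  · rw [uIcc_of_le hεδ]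
    intro s hs
    have hs0 : 0 < s := hε.trans_le hs.1
    have hl := hlog' s hs
    refine ContinuousAt.continuousWithinAt (continuousAt_const.mul (continuousAt_const.div
      (continuousAt_id.mul ((continuousAt_const.div continuousAt_id hs0.ne').log ?_)) ?_))
    · exact (by positivity : 2 * π * κ / s ≠ 0)
    · exact (by positivity : s * Real.log (2 * π * κ / s) ≠ 0)
  · simpa using (hgi.mono_set hsub).comp_add_right (π / 2)
  · intro s hs
    have hs0 : 0 < s := hε.trans_le hs.1
    have hl := hlog' s hs
    have h1 := one_div_log_le_quantileFn_flatDensity hκ hs0 (by linarith [hs.2]) hl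
    have h2 := one_div_le_neg_im_cosineKernel hε ⟨hs.1, hs.2.trans hδ⟩
    have habs : |s + π / 2| = π / 2 + s := by rw [abs_of_pos (by linarith), add_comm]
    simp only [hg, habs, ← mul_neg]
    calc 1 / 8 * (1 / (s * Real.log (2 * π * κ / s)))
        = 1 / Real.log (2 * π * κ / s) * (1 / (8 * s)) := by field_simp
      _ ≤ _ := mul_le_mul h1 h2 (by positivity) (le_trans (by positivity) h1)

end Divergence

/-- For the probability measure with the very flat density `ρ(x) = κ e^{−1/|x|}` on
`(−1,1)`, Gross' power series `Φ(z) = Σ_{n≥1} aₙ zⁿ` converges on the open unit disc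
but its image `Φ(𝔻)` is unbounded, even though the support `(−1,1)` of `μ` is bounded
and connected. -/
theorem gross_domain_unbounded_for_flat_density
    (κ : ℝ) (hκ : 0 < κ)
    (hnorm : ∫ x in (-1 : ℝ)..1, κ * Real.exp (-1 / |x|) = 1)
    (μ : Measure ℝ) [IsProbabilityMeasure μ]
    (hdens : μ = volume.withDensity (fun x =>
      ENNReal.ofReal (if x ∈ Ioo (-1 : ℝ) 1 then κ * Real.exp (-1 / |x|) else 0)))
    (φ : ℝ → ℝ) (hφ : ∀ θ, φ θ = quantileFn μ (|θ| / π))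
    (aa : ℕ → ℝ)
    (ha : ∀ n : ℕ, aa n = (1 / π) * ∫ θ in (-π)..π, φ θ * Real.cos (n * θ)) :
    (∀ z ∈ Metric.ball (0 : ℂ) 1,
        Summable fun n : ℕ => (aa (n + 1) : ℂ) * z ^ (n + 1)) ∧
    ¬ ∃ C : ℝ, ∀ z ∈ Metric.ball (0 : ℂ) 1,
        ‖∑' n : ℕ, (aa (n + 1) : ℂ) * z ^ (n + 1)‖ ≤ C := by
  obtain rfl : φ = fun θ => quantileFn μ (|θ| / π) := funext hφ
  change μ = volume.withDensity (flatDensity κ) at hdens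
  subst hdens
  have hpi := Real.pi_pos
  have hint := intervalIntegrable_quantileFn_abs_div_pi
    (cdfFn_flatDensity_neg_one (κ := κ)) cdfFn_flatDensity_one
  have hsum : ∀ z : ℂ, ‖z‖ < 1 → HasSum (fun n : ℕ => (aa (n + 1) : ℂ) * z ^ (n + 1)) _ :=
    fun z hz => by
      simp only [ha]
      refine hasSum_cosineCoeff hint (fun θ hθ => ?_) hz
      exact abs_quantileFn_le_one cdfFn_flatDensity_neg_one cdfFn_flatDensity_one
        ⟨by positivity, (div_le_one hpi).2 (abs_le.2 hθ)⟩
  refine ⟨fun z hz => (hsum z (by simpa using hz)).summable, ?_⟩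
  rintro ⟨C, hC⟩
  have hδ : 0 < min 1 (2 * π * κ / Real.exp 1) := by positivity
  have hlog : 1 ≤ Real.log (2 * π * κ / min 1 (2 * π * κ / Real.exp 1)) := by
    rw [Real.le_log_iff_exp_le (by positivity), le_div_iff₀ hδ, ← le_div_iff₀' (Real.exp_pos 1)]
    exact min_le_right _ _
  obtain ⟨ε, hlarge, hε⟩ := (((tendsto_integral_one_div_mul_log (by positivity) hδ
    hlog).eventually_gt_atTop (8 * π * C)).and (Ioo_mem_nhdsGT hδ)).exists
  have hε1 : ε < 1 := hε.2.trans_le (min_le_left _ _)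
  have hr : 1 - ε / 4 ∈ Ioo (0 : ℝ) 1 := ⟨by linarith, by linarith [hε.1]⟩
  have hz : ‖((1 - ε / 4 : ℝ) * Complex.I : ℂ)‖ < 1 := by
    rw [norm_mul, Complex.norm_I, mul_one, Complex.norm_real, Real.norm_eq_abs, abs_of_pos hr.1]
    exact hr.2
  have hbound := hC _ (mem_ball_zero_iff.2 hz)
  rw [(hsum _ hz).tsum_eq] at hbound
  have him := (neg_le_abs _).trans ((Complex.abs_im_le_norm _).trans hbound)
  rw [im_integral_mul_cosineKernel hint hr, ← mul_neg, one_div, inv_mul_le_iff₀ hpi] at him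
  have hle := integral_one_div_mul_log_le hκ hε.1 hε.2.le (min_le_left _ _) hlog
  linarith
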